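/- arXiv:1910.05556 — 9 statements merged into one kernel-verified Lean document; each statement's English description precedes it below -/
import Mathlib

section
/- Let A be a bounded residuated distributive lattice-ordered groupoid (brdg) and let F, G, H be prime filters of A. Then the following are equivalent: (i) for all a, b ∈ A, if a ∈ F and b ∈ G then a ∘ b ∈ H; (ii) for all a, b ∈ A, if a ∈ F and a \ b ∈ G then b ∈ H; (iii) for all a, b ∈ A, if b / a ∈ F and a ∈ G then b ∈ H. -/
/-- A prime filter of a bounded distributive lattice. -/
def IsPrimeFilter {A : Type*} [DistribLattice A] [BoundedOrder A] (F : Set A) : Prop :=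
  (⊤ : A) ∈ F ∧ (⊥ : A) ∉ F ∧
  (∀ a b : A, a ∈ F → a ≤ b → b ∈ F) ∧
  (∀ a b : A, a ∈ F → b ∈ F → a ⊓ b ∈ F) ∧
  (∀ a b : A, a ⊔ b ∈ F → a ∈ F ∨ b ∈ F)

/-- equivalence of the three descriptions of the ternary relation on prime
filters of a brdg. -/
theorem stmt4 (A : Type*) [DistribLattice A] [BoundedOrder A]
    (circ ldiv rdiv : A → A → A)
    (res₁ : ∀ x y z : A, circ x y ≤ z ↔ y ≤ ldiv x z)
    (res₂ : ∀ x y z : A, circ x y ≤ z ↔ x ≤ rdiv z y)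
    (F G H : Set A)
    (hF : IsPrimeFilter F) (hG : IsPrimeFilter G) (hH : IsPrimeFilter H) :
    ((∀ a b : A, a ∈ F → b ∈ G → circ a b ∈ H) ↔
      (∀ a b : A, a ∈ F → ldiv a b ∈ G → b ∈ H)) ∧
    ((∀ a b : A, a ∈ F → b ∈ G → circ a b ∈ H) ↔
      (∀ a b : A, rdiv b a ∈ F → a ∈ G → b ∈ H)) := by
  obtain ⟨-, -, uF, -, -⟩ := hF
  obtain ⟨-, -, uG, -, -⟩ := hG
  obtain ⟨-, -, uH, -, -⟩ := hH
  refine ⟨⟨fun h a b ha hb => ?_, fun h a b ha hb => ?_⟩,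
    ⟨fun h a b ha hb => ?_, fun h a b ha hb => ?_⟩⟩
  · exact uH _ _ (h _ _ ha hb) ((res₁ _ _ _).2 le_rfl)
  · exact h a _ ha (uG _ _ hb ((res₁ _ _ _).1 le_rfl))
  · exact uH _ _ (h _ _ ha hb) ((res₂ _ _ _).2 le_rfl)
  · exact h b _ (uF _ _ ha ((res₂ _ _ _).1 le_rfl)) hb
end

section
/- Let A be a bounded residuated distributive lattice-ordered groupoid (brdg), let a, b ∈ A, and let H be a prime filter of A with a ∘ b ∈ H. Then there exist prime filters F and G of A such that a ∈ F, b ∈ G, and R(F, G, H), where R(F, G, H) means that for all c, d ∈ A, c ∈ F and d ∈ G imply c ∘ d ∈ H. -/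
theorem exists_primeFilter_aux {A : Type*} [DistribLattice A] [BoundedOrder A] (I : Set A)
    (h0 : ⊥ ∈ I) (hd : ∀ x y : A, x ≤ y → y ∈ I → x ∈ I)
    (hs : ∀ x y : A, x ∈ I → y ∈ I → x ⊔ y ∈ I) (a : A) (ha : a ∉ I) :
    ∃ F : Set A, IsPrimeFilter F ∧ a ∈ F ∧ ∀ x ∈ F, x ∉ I := by
  let J : Order.Ideal A :=
    { carrier := I
      lower' := fun y x hxy hy => hd x y hxy hy
      nonempty' := ⟨⊥, h0⟩
      directed' := fun x hx y hy => ⟨x ⊔ y, hs x y hx hy, le_sup_left, le_sup_right⟩ }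
  have hdis : Disjoint ((Order.PFilter.principal a : Order.PFilter A) : Set A) (J : Set A) := by
    rw [Set.disjoint_left]
    intro x hx hxI
    exact ha (hd a x (Order.PFilter.mem_principal.1 hx) hxI)
  obtain ⟨K, hK, hJK, hdK⟩ := DistribLattice.prime_ideal_of_disjoint_filter_ideal hdis
  rw [Set.disjoint_left] at hdK
  have haK : a ∉ K := fun h => hdK (Order.PFilter.mem_principal.2 le_rfl) h
  refine ⟨{x | x ∉ K}, ⟨?_, ?_, ?_, ?_, ?_⟩, haK, fun x hx hxI => hx (hJK hxI)⟩
  · exact fun h => haK (K.lower le_top h)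
  · exact fun h => h (hJK h0)
  · exact fun x y hx hxy hy => hx (K.lower hxy hy)
  · intro x y hx hy h
    exact (hK.mem_or_mem h).elim hx hy
  · intro x y h
    by_contra hc
    have hc' : ¬ (x ∉ K ∨ y ∉ K) := hc
    push Not at hc'
    exact h (Order.Ideal.sup_mem hc'.1 hc'.2)

/-- if `a ∘ b ∈ H` for a prime filter `H` of a brdg, then there are prime
filters `F, G` with `a ∈ F`, `b ∈ G` and `R(F,G,H)`. -/
theorem stmt5 (A : Type*) [DistribLattice A] [BoundedOrder A]
    (circ ldiv rdiv : A → A → A)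
    (res₁ : ∀ x y z : A, circ x y ≤ z ↔ y ≤ ldiv x z)
    (res₂ : ∀ x y z : A, circ x y ≤ z ↔ x ≤ rdiv z y)
    (a b : A) (H : Set A) (hH : IsPrimeFilter H) (hab : circ a b ∈ H) :
    ∃ F G : Set A, IsPrimeFilter F ∧ IsPrimeFilter G ∧ a ∈ F ∧ b ∈ G ∧
      ∀ c d : A, c ∈ F → d ∈ G → circ c d ∈ H := by
  obtain ⟨-, hb, hup, -, hpr⟩ := hH
  have mono : ∀ c c' d d' : A, c ≤ c' → d ≤ d' → circ c d ≤ circ c' d' := by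
    intro c c' d d' hc hd
    have h1 : circ c d ≤ circ c' d := (res₂ _ _ _).2 (hc.trans ((res₂ _ _ _).1 le_rfl))
    have h2 : circ c' d ≤ circ c' d' := (res₁ _ _ _).2 (hd.trans ((res₁ _ _ _).1 le_rfl))
    exact h1.trans h2
  obtain ⟨F, hF, haF, hFI⟩ := exists_primeFilter_aux {c | circ c b ∉ H}
    (fun h => hb (hup _ _ h ((res₂ _ _ _).2 bot_le)))
    (fun x y hxy hy hx => hy (hup _ _ hx (mono _ _ _ _ hxy le_rfl)))
    (fun x y hx hy h => by
      have hle : circ (x ⊔ y) b ≤ circ x b ⊔ circ y b :=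
        (res₂ _ _ _).2 (sup_le ((res₂ _ _ _).1 le_sup_left) ((res₂ _ _ _).1 le_sup_right))
      exact (hpr _ _ (hup _ _ h hle)).elim hx hy) a (fun h => h hab)
  obtain ⟨G, hG, hbG, hGI⟩ := exists_primeFilter_aux {d | ∃ c ∈ F, circ c d ∉ H}
    ⟨⊤, hF.1, fun h => hb (hup _ _ h ((res₁ _ _ _).2 bot_le))⟩
    (fun x y hxy ⟨c, hc, hy⟩ => ⟨c, hc, fun hx => hy (hup _ _ hx (mono _ _ _ _ le_rfl hxy))⟩)
    (fun x y ⟨c, hc, hx⟩ ⟨d, hd, hy⟩ => ⟨c ⊓ d, hF.2.2.2.1 _ _ hc hd, fun h => by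
      have hle : circ (c ⊓ d) (x ⊔ y) ≤ circ c x ⊔ circ d y :=
        (res₁ _ _ _).2 (sup_le
          ((res₁ _ _ _).1 ((mono _ _ _ _ inf_le_left le_rfl).trans le_sup_left))
          ((res₁ _ _ _).1 ((mono _ _ _ _ inf_le_right le_rfl).trans le_sup_right)))
      exact (hpr _ _ (hup _ _ h hle)).elim hx hy⟩) b
    (fun ⟨c, hc, h⟩ => hFI c hc h)
  refine ⟨F, G, hF, hG, haF, hbG, fun c d hc hd => ?_⟩
  by_contra h
  exact hGI d hd ⟨c, hc, h⟩
end

section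
/- Let A be a bounded residuated distributive lattice-ordered groupoid (brdg), let a, b ∈ A, and let G be a prime filter of A with a \ b ∉ G. Then there exist prime filters F and H of A such that a ∈ F, b ∉ H, and R(F, G, H), where R(F, G, H) means that for all c, d ∈ A, c ∈ F and d ∈ G imply c ∘ d ∈ H. -/
theorem sep_aux {A : Type*} [DistribLattice A] [BoundedOrder A] (X Y : Set A)
    (x1 : (⊤ : A) ∈ X) (x2 : ∀ a b : A, a ∈ X → a ≤ b → b ∈ X)
    (x3 : ∀ a b : A, a ∈ X → b ∈ X → a ⊓ b ∈ X)
    (y1 : (⊥ : A) ∈ Y) (y2 : ∀ a b : A, b ∈ Y → a ≤ b → a ∈ Y)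
    (y3 : ∀ a b : A, a ∈ Y → b ∈ Y → a ⊔ b ∈ Y)
    (hd : ∀ a, a ∈ X → a ∉ Y) :
    ∃ F : Set A, IsPrimeFilter F ∧ (∀ a ∈ X, a ∈ F) ∧ (∀ a ∈ Y, a ∉ F) := by
  have hX : Order.IsPFilter X := Order.IsPFilter.of_def ⟨_, x1⟩
    (fun a ha b hb => ⟨a ⊓ b, x3 a b ha hb, inf_le_left, inf_le_right⟩)
    (fun {a b} hab ha => x2 a b ha hab)
  have hY : Order.IsIdeal Y :=
    ⟨fun a b hab ha => y2 b a ha hab, ⟨_, y1⟩,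
      fun a ha b hb => ⟨a ⊔ b, y3 a b ha hb, le_sup_left, le_sup_right⟩⟩
  obtain ⟨J, hJ, hIJ, hdis⟩ := DistribLattice.prime_ideal_of_disjoint_filter_ideal
    (F := hX.toPFilter) (I := hY.toIdeal) (Set.disjoint_left.2 hd)
  have hXJ : ∀ a ∈ X, a ∉ J := fun a ha => Set.disjoint_left.1 hdis ha
  refine ⟨{x | x ∉ J}, ⟨hXJ _ x1, fun h => h J.bot_mem, fun a b ha hab hb => ha (J.lower hab hb),
    fun a b ha hb h => ?_, fun a b h => ?_⟩, hXJ, fun a ha h => h (hIJ ha)⟩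
  · exact (hJ.mem_or_mem h).elim ha hb
  · by_contra hc
    simp only [Set.mem_setOf_eq, not_or, not_not] at hc
    exact h (Order.Ideal.sup_mem hc.1 hc.2)

/-- if `a \ b ∉ G` for a prime filter `G` of a brdg, then there are prime
filters `F, H` with `a ∈ F`, `b ∉ H` and `R(F,G,H)`. -/
theorem stmt6 (A : Type*) [DistribLattice A] [BoundedOrder A]
    (circ ldiv rdiv : A → A → A)
    (res₁ : ∀ x y z : A, circ x y ≤ z ↔ y ≤ ldiv x z)
    (res₂ : ∀ x y z : A, circ x y ≤ z ↔ x ≤ rdiv z y)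
    (a b : A) (G : Set A) (hG : IsPrimeFilter G) (hab : ldiv a b ∉ G) :
    ∃ F H : Set A, IsPrimeFilter F ∧ IsPrimeFilter H ∧ a ∈ F ∧ b ∉ H ∧
      ∀ c d : A, c ∈ F → d ∈ G → circ c d ∈ H := by
  obtain ⟨g1, g2, g3, g4, g5⟩ := hG
  have mono : ∀ x x' y y' : A, x ≤ x' → y ≤ y' → circ x y ≤ circ x' y' := by
    intro x x' y y' hx hy
    have h1 : circ x y' ≤ circ x' y' := (res₂ _ _ _).2 (hx.trans ((res₂ _ _ _).1 le_rfl))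
    exact ((res₁ _ _ _).2 (hy.trans ((res₁ _ _ _).1 le_rfl))).trans h1
  obtain ⟨H, hH, hXH, hYH⟩ := sep_aux {x | ∃ d ∈ G, circ a d ≤ x} {x | x ≤ b}
    ⟨⊤, g1, le_top⟩ (fun x y ⟨d, hd, h⟩ hxy => ⟨d, hd, h.trans hxy⟩)
    (fun x y ⟨d, hd, h⟩ ⟨e, he, h'⟩ => ⟨d ⊓ e, g4 _ _ hd he,
      le_inf ((mono _ _ _ _ le_rfl inf_le_left).trans h)
        ((mono _ _ _ _ le_rfl inf_le_right).trans h')⟩)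
    bot_le (fun x y h h' => le_trans h' h) (fun x y h h' => sup_le h h')
    (fun x ⟨d, hd, h⟩ h' => hab (g3 _ _ hd ((res₁ _ _ _).1 (h.trans h'))))
  have hH' := hH
  obtain ⟨h1, h2, h3, h4, h5⟩ := hH'
  obtain ⟨F, hF, hXF, hYF⟩ := sep_aux {x | a ≤ x} {c | ∃ d ∈ G, circ c d ∉ H}
    le_top (fun x y h h' => le_trans h h') (fun x y h h' => le_inf h h')
    ⟨⊤, g1, fun h => h2 (h3 _ _ h ((res₂ _ _ _).2 bot_le))⟩
    (fun x y ⟨d, hd, h⟩ hxy => ⟨d, hd, fun hh => h (h3 _ _ hh (mono _ _ _ _ hxy le_rfl))⟩)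
    (fun x y ⟨d, hd, h⟩ ⟨e, he, h'⟩ => ⟨d ⊓ e, g4 _ _ hd he, fun hh => by
      have hle : circ (x ⊔ y) (d ⊓ e) ≤ circ x d ⊔ circ y e :=
        (res₂ _ _ _).2 (sup_le
          ((res₂ _ _ _).1 ((mono _ _ _ _ le_rfl inf_le_left).trans le_sup_left))
          ((res₂ _ _ _).1 ((mono _ _ _ _ le_rfl inf_le_right).trans le_sup_right)))
      exact (h5 _ _ (h3 _ _ hh hle)).elim h h'⟩)
    (fun x hx ⟨d, hd, h⟩ => h (hXH _ ⟨d, hd, mono _ _ _ _ hx le_rfl⟩))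
  refine ⟨F, H, hF, hH, hXF a le_rfl, hYH b le_rfl, fun c d hc hd => ?_⟩
  by_contra hcd
  exact hYF c ⟨d, hd, hcd⟩ hc
end

section
/- Let A be a bounded residuated distributive lattice-ordered groupoid (brdg), let a, b ∈ A, and let F be a prime filter of A with b / a ∉ F. Then there exist prime filters G and H of A such that a ∈ G, b ∉ H, and R(F, G, H), where R(F, G, H) means that for all c, d ∈ A, c ∈ F and d ∈ G imply c ∘ d ∈ H. -/
theorem sep_aux_s7 {A : Type*} [DistribLattice A] [BoundedOrder A] (P I : Set A)
    (h1 : (⊤ : A) ∈ P) (hu : ∀ a b : A, a ∈ P → a ≤ b → b ∈ P)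
    (hi : ∀ a b : A, a ∈ P → b ∈ P → a ⊓ b ∈ P)
    (h0 : (⊥ : A) ∈ I) (hd : ∀ a b : A, a ∈ I → b ≤ a → b ∈ I)
    (hs : ∀ a b : A, a ∈ I → b ∈ I → a ⊔ b ∈ I)
    (hPI : ∀ x, x ∈ P → x ∉ I) :
    ∃ G : Set A, IsPrimeFilter G ∧ (∀ x ∈ P, x ∈ G) ∧ (∀ x ∈ I, x ∉ G) := by
  have hP : Order.IsPFilter P := Order.IsPFilter.of_def ⟨_, h1⟩
    (fun x hx y hy => ⟨x ⊓ y, hi x y hx hy, inf_le_left, inf_le_right⟩)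
    (fun {x y} hxy hx => hu x y hx hxy)
  let I' : Order.Ideal A :=
    { carrier := I
      lower' := fun x y hxy hx => hd x y hx hxy
      nonempty' := ⟨_, h0⟩
      directed' := fun x hx y hy => ⟨x ⊔ y, hs x y hx hy, le_sup_left, le_sup_right⟩ }
  have hdis : Disjoint (hP.toPFilter : Set A) (I' : Set A) :=
    Set.disjoint_left.2 fun x hx hx' => hPI x hx hx'
  obtain ⟨J, hJ, hIJ, hPJ⟩ := DistribLattice.prime_ideal_of_disjoint_filter_ideal hdis
  have hPJ' : ∀ x ∈ P, x ∉ J := fun x hx hxJ => Set.disjoint_left.1 hPJ hx hxJ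
  refine ⟨{x | x ∉ J}, ⟨hPJ' _ h1, fun h => h J.bot_mem, fun x y hx hxy hy => hx (J.lower hxy hy),
    fun x y hx hy h => (hJ.mem_or_mem h).elim hx hy, fun x y h => ?_⟩, hPJ',
    fun x hx h => h (hIJ hx)⟩
  by_contra hc
  simp only [Set.mem_setOf_eq, not_or, not_not] at hc
  exact h (J.sup_mem hc.1 hc.2)

/-- if `b / a ∉ F` for a prime filter `F` of a brdg, then there are prime
filters `G, H` with `a ∈ G`, `b ∉ H` and `R(F,G,H)`. -/
theorem stmt7 (A : Type*) [DistribLattice A] [BoundedOrder A]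
    (circ ldiv rdiv : A → A → A)
    (res₁ : ∀ x y z : A, circ x y ≤ z ↔ y ≤ ldiv x z)
    (res₂ : ∀ x y z : A, circ x y ≤ z ↔ x ≤ rdiv z y)
    (a b : A) (F : Set A) (hF : IsPrimeFilter F) (hab : rdiv b a ∉ F) :
    ∃ G H : Set A, IsPrimeFilter G ∧ IsPrimeFilter H ∧ a ∈ G ∧ b ∉ H ∧
      ∀ c d : A, c ∈ F → d ∈ G → circ c d ∈ H := by
  obtain ⟨hF1, hF0, hFu, hFi, hFs⟩ := hF
  have mono : ∀ c c' d d' : A, c ≤ c' → d ≤ d' → circ c d ≤ circ c' d' := fun c c' d d' h h' =>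
    ((res₂ c d _).2 (h.trans ((res₂ c' d _).1
      ((res₁ c' d _).2 (h'.trans ((res₁ c' d' _).1 le_rfl))))))
  obtain ⟨H, hH, hPH, hbH⟩ := sep_aux_s7 {x | ∃ c ∈ F, circ c a ≤ x} {x | x ≤ b}
    ⟨⊤, hF1, le_top⟩ (fun x y ⟨c, hc, h⟩ hxy => ⟨c, hc, h.trans hxy⟩)
    (fun x y ⟨c, hc, h⟩ ⟨c', hc', h'⟩ => ⟨c ⊓ c', hFi _ _ hc hc',
      le_inf ((mono _ _ _ _ inf_le_left le_rfl).trans h)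
        ((mono _ _ _ _ inf_le_right le_rfl).trans h')⟩)
    bot_le (fun x y hx hxy => le_trans hxy hx) (fun x y hx hy => sup_le hx hy)
    (fun x ⟨c, hc, h⟩ hx => hab (hFu _ _ hc ((res₂ _ _ _).1 (le_trans h hx))))
  have hH' := hH
  obtain ⟨hH1, hH0, hHu, hHi, hHs⟩ := hH'
  obtain ⟨G, hG, hPG, hIG⟩ := sep_aux_s7 {x | a ≤ x} {d | ∃ c ∈ F, circ c d ∉ H}
    le_top (fun x y hx hxy => le_trans hx hxy) (fun x y hx hy => le_inf hx hy)
    ⟨⊤, hF1, fun h => hH0 (hHu _ _ h ((res₁ _ _ _).2 bot_le))⟩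
    (fun x y ⟨c, hc, h⟩ hyx => ⟨c, hc, fun h' => h (hHu _ _ h' (mono _ _ _ _ le_rfl hyx))⟩)
    (fun x y ⟨c, hc, h⟩ ⟨c', hc', h'⟩ => ⟨c ⊓ c', hFi _ _ hc hc', fun hm => by
      have : circ (c ⊓ c') (x ⊔ y) ≤ circ c x ⊔ circ c' y :=
        (res₁ _ _ _).2 (sup_le
          ((res₁ _ _ _).1 ((mono _ _ _ _ inf_le_left le_rfl).trans le_sup_left))
          ((res₁ _ _ _).1 ((mono _ _ _ _ inf_le_right le_rfl).trans le_sup_right)))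
      exact (hHs _ _ (hHu _ _ hm this)).elim h h'⟩)
    (fun x hx ⟨c, hc, h⟩ => h (hPH _ ⟨c, hc, mono _ _ _ _ le_rfl hx⟩))
  refine ⟨G, H, hG, hH, hPG a le_rfl, hbH b le_rfl, fun c d hc hd => ?_⟩
  by_contra h
  exact hIG d ⟨c, hc, h⟩ hd
end

section
/- Let A be a bounded residuated distributive lattice-ordered groupoid (brdg), let 𝒫 be the set of prime filters of A, and let ℛ be the ternary relation on 𝒫 defined by ℛ(F, G, H) iff for all a, b ∈ A, a ∈ F and b ∈ G imply a ∘ b ∈ H. Then (𝒫, ⊆, ℛ) is a brdg-frame, and the map μ(a) = {F ∈ 𝒫 : a ∈ F} is an injective map from A into the upward closed subsets of (𝒫, ⊆) satisfying: a ≤ b iff μ(a) ⊆ μ(b); μ(0) = ∅; μ(1) = 𝒫; μ(a ∧ b) = μ(a) ∩ μ(b); μ(a ∨ b) = μ(a) ∪ μ(b); μ(a ∘ b) = μ(a) ∘ μ(b); μ(a \ b) = μ(a) \ μ(b); and μ(a / b) = μ(a) / μ(b), where the operations ∘, \, / on upward closed subsets are the complex operations determined by ℛ. -/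
theorem sep_aux_s9 {A : Type*} [DistribLattice A] [BoundedOrder A] (F I : Set A)
    (ft : (⊤ : A) ∈ F) (fu : ∀ a b : A, a ∈ F → a ≤ b → b ∈ F)
    (fm : ∀ a b : A, a ∈ F → b ∈ F → a ⊓ b ∈ F)
    (ib : (⊥ : A) ∈ I) (id : ∀ a b : A, a ∈ I → b ≤ a → b ∈ I)
    (ij : ∀ a b : A, a ∈ I → b ∈ I → a ⊔ b ∈ I)
    (hd : ∀ a ∈ F, a ∉ I) :
    ∃ G : Set A, IsPrimeFilter G ∧ F ⊆ G ∧ ∀ a ∈ G, a ∉ I := by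
  have hI : Order.IsIdeal I :=
    ⟨fun a b h ha => id a b ha h, ⟨⊥, ib⟩,
      fun a ha b hb => ⟨a ⊔ b, ij a b ha hb, le_sup_left, le_sup_right⟩⟩
  have hF : Order.IsPFilter F :=
    Order.IsPFilter.of_def ⟨⊤, ft⟩
      (fun a ha b hb => ⟨a ⊓ b, fm a b ha hb, inf_le_left, inf_le_right⟩)
      (fun {a b} h ha => fu a b ha h)
  obtain ⟨J, hJ, hIJ, hFJ⟩ := DistribLattice.prime_ideal_of_disjoint_filter_ideal
    (F := hF.toPFilter) (I := hI.toIdeal) (Set.disjoint_left.2 hd)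
  have hFJ' : ∀ a ∈ F, a ∉ J := fun a ha => Set.disjoint_left.1 hFJ ha
  refine ⟨{x | x ∉ J}, ⟨hFJ' _ ft, fun h => h J.bot_mem, fun a b ha hab hb => ha (J.lower hab hb),
    fun a b ha hb h => (hJ.mem_or_mem h).elim ha hb, fun a b h => ?_⟩, hFJ',
    fun a ha h => ha (hIJ h)⟩
  by_contra hc
  simp only [Set.mem_setOf_eq, not_or, not_not] at hc
  exact h (J.sup_mem hc.1 hc.2)

theorem ext_aux {A : Type*} [DistribLattice A] [BoundedOrder A]
    (circ ldiv rdiv : A → A → A)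
    (res₁ : ∀ x y z : A, circ x y ≤ z ↔ y ≤ ldiv x z)
    (res₂ : ∀ x y z : A, circ x y ≤ z ↔ x ≤ rdiv z y)
    (G H : Set A) (gt : ⊤ ∈ G) (gm : ∀ a b : A, a ∈ G → b ∈ G → a ⊓ b ∈ G)
    (hH : IsPrimeFilter H) (a : A) (h : ∀ g ∈ G, circ a g ∈ H) :
    ∃ F : Set A, IsPrimeFilter F ∧ a ∈ F ∧ ∀ x y, x ∈ F → y ∈ G → circ x y ∈ H := by
  obtain ⟨h1, h2, h3, h4, h5⟩ := hH
  have ml : ∀ x x' y, x ≤ x' → circ x y ≤ circ x' y := fun x x' y hx =>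
    (res₂ _ _ _).2 (hx.trans ((res₂ _ _ _).1 le_rfl))
  have mr : ∀ x y y', y ≤ y' → circ x y ≤ circ x y' := fun x y y' hx =>
    (res₁ _ _ _).2 (hx.trans ((res₁ _ _ _).1 le_rfl))
  obtain ⟨F, hF, haF, hn⟩ := sep_aux_s9 (Set.Ici a) {x | ∃ g ∈ G, circ x g ∉ H} le_top
    (fun x y hx hxy => le_trans hx hxy) (fun x y hx hy => le_inf hx hy)
    ⟨⊤, gt, fun hh => h2 (h3 _ _ hh ((res₂ _ _ _).2 bot_le))⟩
    (fun x y ⟨g, hg, hx⟩ hyx => ⟨g, hg, fun hh => hx (h3 _ _ hh (ml _ _ _ hyx))⟩)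
    (by
      rintro x y ⟨g, hg, hx⟩ ⟨k, hk, hy⟩
      refine ⟨g ⊓ k, gm _ _ hg hk, fun hh => ?_⟩
      have : circ (x ⊔ y) (g ⊓ k) ≤ circ x g ⊔ circ y k := (res₂ _ _ _).2 (sup_le
        ((res₂ _ _ _).1 ((mr _ _ _ inf_le_left).trans le_sup_left))
        ((res₂ _ _ _).1 ((mr _ _ _ inf_le_right).trans le_sup_right)))
      exact (h5 _ _ (h3 _ _ hh this)).elim hx hy)
    (fun x hx ⟨g, hg, hxg⟩ => hxg (h3 _ _ (h g hg) (ml _ _ _ hx)))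
  refine ⟨F, hF, haF le_rfl, fun x y hx hy => ?_⟩
  by_contra hc
  exact hn x hx ⟨y, hy, hc⟩

theorem ldiv_aux {A : Type*} [DistribLattice A] [BoundedOrder A]
    (circ ldiv rdiv : A → A → A)
    (res₁ : ∀ x y z : A, circ x y ≤ z ↔ y ≤ ldiv x z)
    (res₂ : ∀ x y z : A, circ x y ≤ z ↔ x ≤ rdiv z y)
    (G : Set A) (hG : IsPrimeFilter G) (a b : A) (h : ldiv a b ∉ G) :
    ∃ F H : Set A, IsPrimeFilter F ∧ IsPrimeFilter H ∧ a ∈ F ∧ b ∉ H ∧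
      ∀ x y, x ∈ F → y ∈ G → circ x y ∈ H := by
  obtain ⟨h1, h2, h3, h4, h5⟩ := hG
  have mr : ∀ x y y', y ≤ y' → circ x y ≤ circ x y' := fun x y y' hx =>
    (res₁ _ _ _).2 (hx.trans ((res₁ _ _ _).1 le_rfl))
  obtain ⟨H, hH, hs, hn⟩ := sep_aux_s9 {z | ∃ g ∈ G, circ a g ≤ z} (Set.Iic b) ⟨⊤, h1, le_top⟩
    (fun x y ⟨g, hg, hx⟩ hxy => ⟨g, hg, hx.trans hxy⟩)
    (fun x y ⟨g, hg, hx⟩ ⟨k, hk, hy⟩ => ⟨g ⊓ k, h4 _ _ hg hk,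
      le_inf ((mr _ _ _ inf_le_left).trans hx) ((mr _ _ _ inf_le_right).trans hy)⟩)
    bot_le (fun x y hx hxy => le_trans hxy hx) (fun x y hx hy => sup_le hx hy)
    (fun x ⟨g, hg, hx⟩ hxb => h (h3 _ _ hg ((res₁ _ _ _).1 (hx.trans hxb))))
  obtain ⟨F, hF, haF, hR⟩ := ext_aux circ ldiv rdiv res₁ res₂ G H h1 h4 hH a
    (fun g hg => hs ⟨g, hg, le_rfl⟩)
  exact ⟨F, H, hF, hH, haF, fun hb => hn b hb le_rfl, hR⟩

/-- the prime filters of a brdg with inclusion and the canonical ternary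
relation form a brdg-frame, and `μ(a) = {F : a ∈ F}` is an embedding of the brdg
into the brdg of upward closed subsets of the frame. -/
theorem stmt9 (A : Type*) [DistribLattice A] [BoundedOrder A]
    (circ ldiv rdiv : A → A → A)
    (res₁ : ∀ x y z : A, circ x y ≤ z ↔ y ≤ ldiv x z)
    (res₂ : ∀ x y z : A, circ x y ≤ z ↔ x ≤ rdiv z y) :
    let P := {F : Set A // IsPrimeFilter F}
    let R : P → P → P → Prop := fun F G H =>
      ∀ a b : A, a ∈ F.1 → b ∈ G.1 → circ a b ∈ H.1
    let μ : A → Set P := fun a => {F | a ∈ F.1}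
    -- (𝒫, ⊆, ℛ) is a brdg-frame:
    (∀ F F' G H : P, R F G H → F'.1 ⊆ F.1 → R F' G H) ∧
    (∀ F G G' H : P, R F G H → G'.1 ⊆ G.1 → R F G' H) ∧
    (∀ F G H H' : P, R F G H → H.1 ⊆ H'.1 → R F G H') ∧
    -- μ maps into the upward closed subsets:
    (∀ a : A, ∀ F G : P, F ∈ μ a → F.1 ⊆ G.1 → G ∈ μ a) ∧
    -- μ is an injective embedding:
    Function.Injective μ ∧
    (∀ a b : A, a ≤ b ↔ μ a ⊆ μ b) ∧
    μ ⊥ = ∅ ∧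
    μ ⊤ = Set.univ ∧
    (∀ a b : A, μ (a ⊓ b) = μ a ∩ μ b) ∧
    (∀ a b : A, μ (a ⊔ b) = μ a ∪ μ b) ∧
    (∀ a b : A, μ (circ a b) = {H : P | ∃ F ∈ μ a, ∃ G ∈ μ b, R F G H}) ∧
    (∀ a b : A, μ (ldiv a b) = {G : P | ∀ F H : P, R F G H → F ∈ μ a → H ∈ μ b}) ∧
    (∀ a b : A, μ (rdiv a b) = {F : P | ∀ G H : P, R F G H → G ∈ μ b → H ∈ μ a}) := by
  intro P R μ
  have key : ∀ a b : A, μ a ⊆ μ b → a ≤ b := by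
    intro a b hab
    by_contra hc
    obtain ⟨G, hG, hs, hn⟩ := sep_aux_s9 (Set.Ici a) (Set.Iic b) le_top
      (fun x y hx hxy => le_trans hx hxy) (fun x y hx hy => le_inf hx hy)
      bot_le (fun x y hx hxy => le_trans hxy hx) (fun x y hx hy => sup_le hx hy)
      (fun x hx hxb => hc (le_trans hx hxb))
    exact hn b (@hab ⟨G, hG⟩ (hs le_rfl)) le_rfl
  refine ⟨fun F F' G H h hs a b ha hb => h a b (hs ha) hb,
    fun F G G' H h hs a b ha hb => h a b ha (hs hb),
    fun F G H H' h hs a b ha hb => hs (h a b ha hb),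
    fun a F G ha hs => hs ha,
    fun a b hab => le_antisymm (key _ _ hab.subset) (key _ _ hab.symm.subset),
    fun a b => ⟨fun h F hF => F.2.2.2.1 _ _ hF h, key a b⟩,
    Set.eq_empty_of_forall_notMem fun F => F.2.2.1,
    Set.eq_univ_of_forall fun F => F.2.1,
    fun a b => Set.ext fun F => ⟨fun h => ⟨F.2.2.2.1 _ _ h inf_le_left,
      F.2.2.2.1 _ _ h inf_le_right⟩, fun h => F.2.2.2.2.1 _ _ h.1 h.2⟩,
    fun a b => Set.ext fun F => ⟨fun h => F.2.2.2.2.2 _ _ h,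
      fun h => h.elim (fun h => F.2.2.2.1 _ _ h le_sup_left)
        (fun h => F.2.2.2.1 _ _ h le_sup_right)⟩,
    fun a b => Set.ext fun H => ⟨fun h => ?_, ?_⟩,
    fun a b => Set.ext fun G => ⟨fun h F H hR ha => ?_, fun h => ?_⟩,
    fun a b => Set.ext fun F => ⟨fun h G H hR hb => ?_, fun h => ?_⟩⟩
  · have mr : ∀ y, b ≤ y → circ a b ≤ circ a y := fun y hx =>
      (res₁ _ _ _).2 (hx.trans ((res₁ _ _ _).1 le_rfl))
    obtain ⟨F, hF, haF, hR⟩ := ext_aux circ ldiv rdiv res₁ res₂ (Set.Ici b) H.1 le_top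
      (fun x y hx hy => le_inf hx hy) H.2 a (fun g hg => H.2.2.2.1 _ _ h (mr g hg))
    obtain ⟨G, hG, hbG, hR'⟩ := ext_aux (fun x y => circ y x) (fun x z => rdiv z x)
      (fun z x => ldiv x z) (fun x y z => res₂ y x z) (fun x y z => res₁ y x z)
      F H.1 hF.1 hF.2.2.2.1 H.2 b (fun g hg => hR g b hg le_rfl)
    exact ⟨⟨F, hF⟩, haF, ⟨G, hG⟩, hbG, fun x y hx hy => hR' y x hy hx⟩
  · rintro ⟨F, hF, G, hG, hR⟩
    exact hR a b hF hG
  · exact H.2.2.2.1 _ _ (hR _ _ ha h) ((res₁ _ _ _).2 le_rfl)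
  · by_contra hc
    obtain ⟨F, H, hF, hH, haF, hbH, hR⟩ := ldiv_aux circ ldiv rdiv res₁ res₂ G.1 G.2 a b hc
    exact hbH (h ⟨F, hF⟩ ⟨H, hH⟩ hR haF)
  · exact H.2.2.2.1 _ _ (hR _ _ h hb) ((res₂ _ _ _).2 le_rfl)
  · by_contra hc
    obtain ⟨G, H, hG, hH, hbG, haH, hR⟩ := ldiv_aux (fun x y => circ y x) (fun x z => rdiv z x)
      (fun z x => ldiv x z) (fun x y z => res₂ y x z) (fun x y z => res₁ y x z) F.1 F.2 b a hc
    exact haH (h ⟨G, hG⟩ ⟨H, hH⟩ (fun x y hx hy => hR y x hy hx) hbG)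
end

section
/- Let A be a bounded distributive lattice with operator (bdo), let F be a prime filter of A, and let a ∈ A with ◇a ∈ F. Then there exists a prime filter G of A such that a ∈ G and ℛ(F, G), where ℛ(F, G) means that for all b ∈ A, b ∈ G implies ◇b ∈ F. -/
/-- in a bdo, if `◇a ∈ F` for a prime filter `F`, then there is a prime
filter `G` with `a ∈ G` and `ℛ(F, G)`. -/
theorem stmt10 (A : Type*) [DistribLattice A] [BoundedOrder A]
    (dia : A → A) (hd0 : dia ⊥ = ⊥)
    (hdj : ∀ x y : A, dia (x ⊔ y) = dia x ⊔ dia y)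
    (F : Set A) (hF : IsPrimeFilter F) (a : A) (ha : dia a ∈ F) :
    ∃ G : Set A, IsPrimeFilter G ∧ a ∈ G ∧ ∀ b : A, b ∈ G → dia b ∈ F := by
  obtain ⟨-, hbot, hup, -, hprime⟩ := hF
  have mono : ∀ x y : A, x ≤ y → dia x ≤ dia y := fun x y h => by
    rw [← sup_eq_right.mpr h, hdj]; exact le_sup_left
  let I : Order.Ideal A :=
    { carrier := {b | dia b ∉ F}
      lower' := fun x y h hx hy => hx (hup _ _ hy (mono _ _ h))
      nonempty' := ⟨⊥, by simpa [hd0] using hbot⟩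
      directed' := fun x hx y hy => ⟨x ⊔ y, fun h => by
        rw [hdj] at h
        exact (hprime _ _ h).elim hx hy, le_sup_left, le_sup_right⟩ }
  have hdis : Disjoint (Order.PFilter.principal a : Set A) (I : Set A) := by
    rw [Set.disjoint_left]
    intro x hx hxI
    have hx' : a ≤ x := Order.PFilter.mem_principal.mp hx
    exact hxI (hup _ _ ha (mono _ _ hx'))
  obtain ⟨J, hJ, hIJ, hd⟩ := DistribLattice.prime_ideal_of_disjoint_filter_ideal hdis
  have haJ : a ∉ J := fun h =>
    Set.disjoint_left.mp hd (Order.PFilter.mem_principal.mpr le_rfl) h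
  refine ⟨{x | x ∉ J}, ⟨?_, ?_, ?_, ?_, ?_⟩, haJ, ?_⟩
  · exact fun h => haJ (J.lower le_top h)
  · exact fun h => h J.bot_mem
  · exact fun x y hx h hy => hx (J.lower h hy)
  · exact fun x y hx hy h => (hJ.mem_or_mem h).elim hx hy
  · intro x y h
    by_contra hc
    simp only [Set.mem_setOf_eq, not_or, not_not] at hc
    exact h (Order.Ideal.sup_mem hc.1 hc.2)
  · intro b hb
    by_contra hc
    exact hb (hIJ hc)
end

section
/- Let A be a bounded distributive lattice with operator (bdo), let 𝒫 be the set of prime filters of A, and let ℛ be the binary relation on 𝒫 defined by ℛ(F, G) iff for all a ∈ A, a ∈ G implies ◇a ∈ F. Then (𝒫, ⊆, ℛ) is a bdo-frame, and the map μ(a) = {F ∈ 𝒫 : a ∈ F} is an injective map from A into the upward closed subsets of (𝒫, ⊆) satisfying: a ≤ b iff μ(a) ⊆ μ(b); μ(0) = ∅; μ(1) = 𝒫; μ(a ∧ b) = μ(a) ∩ μ(b); μ(a ∨ b) = μ(a) ∪ μ(b); and μ(◇a) = ◇μ(a), where ◇X = {F ∈ 𝒫 : ∃ G ∈ 𝒫,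 G ∈ X and ℛ(F, G)}. -/
theorem exists_primeFilter_sep {A : Type*} [DistribLattice A] [BoundedOrder A]
    (I : Set A) (h0 : ⊥ ∈ I) (hl : ∀ x y : A, y ≤ x → x ∈ I → y ∈ I)
    (hs : ∀ x y : A, x ∈ I → y ∈ I → x ⊔ y ∈ I) (a : A) (ha : a ∉ I) :
    ∃ G : Set A, IsPrimeFilter G ∧ a ∈ G ∧ ∀ x ∈ G, x ∉ I := by
  let J : Order.Ideal A :=
    { carrier := I
      lower' := fun x y h hx => hl x y h hx
      nonempty' := ⟨⊥, h0⟩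
      directed' := fun x hx y hy => ⟨x ⊔ y, hs x y hx hy, le_sup_left, le_sup_right⟩ }
  have hd : Disjoint ((Order.PFilter.principal a : Order.PFilter A) : Set A) (J : Set A) := by
    rw [Set.disjoint_left]
    intro x hx hxI
    have hx' : a ≤ x := Order.PFilter.mem_principal.1 hx
    exact ha (hl x a hx' hxI)
  obtain ⟨K, hK, hIK, hKd⟩ := DistribLattice.prime_ideal_of_disjoint_filter_ideal hd
  have haK : a ∉ K := fun h =>
    Set.disjoint_left.1 hKd (Order.PFilter.mem_principal.2 le_rfl) h
  refine ⟨{x | x ∉ K}, ⟨?_, ?_, ?_, ?_, ?_⟩, haK, ?_⟩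
  · exact fun h => haK (K.lower le_top h)
  · exact fun h => h K.bot_mem
  · exact fun x y hx hxy hy => hx (K.lower hxy hy)
  · exact fun x y hx hy h => (hK.mem_or_mem h).elim hx hy
  · intro x y h
    by_contra hc
    simp only [Set.mem_setOf_eq, not_or, not_not] at hc
    exact h (Order.Ideal.sup_mem hc.1 hc.2)
  · exact fun x hx hxI => hx (hIK hxI)

/-- the prime filters of a bdo with inclusion and the canonical binary
relation form a bdo-frame, and `μ(a) = {F : a ∈ F}` is an embedding of the bdo
into the bdo of upward closed subsets of the frame. -/
theorem stmt12 (A : Type*) [DistribLattice A] [BoundedOrder A]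
    (dia : A → A) (hd0 : dia ⊥ = ⊥)
    (hdj : ∀ x y : A, dia (x ⊔ y) = dia x ⊔ dia y) :
    let P := {F : Set A // IsPrimeFilter F}
    let R : P → P → Prop := fun F G => ∀ a : A, a ∈ G.1 → dia a ∈ F.1
    let μ : A → Set P := fun a => {F | a ∈ F.1}
    -- (𝒫, ⊆, ℛ) is a bdo-frame:
    (∀ F F' G : P, R F G → F.1 ⊆ F'.1 → R F' G) ∧
    -- μ maps into the upward closed subsets:
    (∀ a : A, ∀ F G : P, F ∈ μ a → F.1 ⊆ G.1 → G ∈ μ a) ∧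
    -- μ is an injective embedding:
    Function.Injective μ ∧
    (∀ a b : A, a ≤ b ↔ μ a ⊆ μ b) ∧
    μ ⊥ = ∅ ∧
    μ ⊤ = Set.univ ∧
    (∀ a b : A, μ (a ⊓ b) = μ a ∩ μ b) ∧
    (∀ a b : A, μ (a ⊔ b) = μ a ∪ μ b) ∧
    (∀ a : A, μ (dia a) = {F : P | ∃ G ∈ μ a, R F G}) := by
  intro P R μ
  have hle : ∀ a b : A, a ≤ b ↔ μ a ⊆ μ b := by
    intro a b
    refine ⟨fun h F hF => F.2.2.2.1 a b hF h, fun h => ?_⟩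
    by_contra hab
    obtain ⟨G, hG, haG, hGI⟩ := exists_primeFilter_sep {x | x ≤ b} bot_le
      (fun x y h hx => le_trans h hx) (fun x y hx hy => sup_le hx hy) a hab
    exact hGI b (h (show (⟨G, hG⟩ : P) ∈ μ a from haG)) le_rfl
  have hmono : ∀ x y : A, x ≤ y → dia x ≤ dia y := by
    intro x y h
    rw [← sup_eq_right.2 h, hdj]
    exact le_sup_left
  refine ⟨fun F F' G h hF a ha => hF (h a ha), fun a F G h hFG => hFG h, ?_, hle, ?_, ?_, ?_,
    ?_, ?_⟩
  · intro a b h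
    exact le_antisymm ((hle a b).2 h.subset) ((hle b a).2 h.symm.subset)
  · ext F
    exact ⟨fun h => F.2.2.1 h, fun h => h.elim⟩
  · ext F
    exact ⟨fun _ => trivial, fun _ => F.2.1⟩
  · intro a b
    ext F
    exact ⟨fun h => ⟨F.2.2.2.1 _ _ h inf_le_left, F.2.2.2.1 _ _ h inf_le_right⟩,
      fun h => F.2.2.2.2.1 _ _ h.1 h.2⟩
  · intro a b
    ext F
    exact ⟨fun h => F.2.2.2.2.2 _ _ h, fun h => h.elim
      (fun h => F.2.2.2.1 _ _ h le_sup_left) (fun h => F.2.2.2.1 _ _ h le_sup_right)⟩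
  · intro a
    ext F
    refine ⟨fun h => ?_, fun ⟨G, hG, hR⟩ => hR a hG⟩
    obtain ⟨G, hG, haG, hGI⟩ := exists_primeFilter_sep {x | dia x ∉ F.1}
      (fun h => F.2.2.1 (by rwa [hd0] at h))
      (fun x y hyx hx hy => hx (F.2.2.2.1 _ _ hy (hmono _ _ hyx)))
      (fun x y hx hy hxy => by
        rw [hdj] at hxy
        exact (F.2.2.2.2.2 _ _ hxy).elim hx hy) a (fun hn => hn h)
    exact ⟨⟨G, hG⟩, haG, fun x hx => by_contra fun hn => hGI x hx hn⟩
end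

section
/- Every bounded distributive lattice with binary operator (bdbo) embeds into a bounded residuated distributive lattice-ordered groupoid (brdg): for every bdbo A there exist a brdg B and an injective map μ : A → B such that for all a, b ∈ A, a ≤ b iff μ(a) ≤ μ(b), μ(0) = 0, μ(1) = 1, μ(a ∧ b) = μ(a) ∧ μ(b), μ(a ∨ b) = μ(a) ∨ μ(b), and μ(a ∘ b) = μ(a) ∘ μ(b). -/
theorem exists_prime_sep {A : Type*} [DistribLattice A] [BoundedOrder A] (I : Order.Ideal A) (a : A)
    (ha : a ∉ I) : ∃ P : Order.Ideal A, P.IsPrime ∧ (∀ x ∈ I, x ∈ P) ∧ a ∉ P := by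
  have h : Disjoint ((Order.PFilter.principal a : Order.PFilter A) : Set A) (I : Set A) := by
    rw [Set.disjoint_left]
    intro x hx hxI
    exact ha (I.lower (Order.PFilter.mem_principal.1 hx) hxI)
  obtain ⟨J, hJ, hIJ, hd⟩ := DistribLattice.prime_ideal_of_disjoint_filter_ideal h
  exact ⟨J, hJ, fun x hx => hIJ hx,
    Set.disjoint_left.1 hd (Order.PFilter.mem_principal.2 le_rfl)⟩

theorem exists_prime_sep_set {A : Type*} [DistribLattice A] [BoundedOrder A] (I : Set A)
    (h0 : ⊥ ∈ I) (hl : ∀ x y, x ≤ y → y ∈ I → x ∈ I) (hs : ∀ x y, x ∈ I → y ∈ I → x ⊔ y ∈ I)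
    (a : A) (ha : a ∉ I) :
    ∃ P : Order.Ideal A, P.IsPrime ∧ (∀ x ∈ I, x ∈ P) ∧ a ∉ P :=
  exists_prime_sep (A := A)
    { carrier := I
      lower' := fun x y hxy hx => hl y x hxy hx
      nonempty' := ⟨⊥, h0⟩
      directed' := fun x hx y hy => ⟨x ⊔ y, hs x y hx hy, le_sup_left, le_sup_right⟩ } a ha

/-- every bdbo embeds into a brdg. -/
theorem stmt15 (A : Type u) [DistribLattice A] [BoundedOrder A]
    (circ : A → A → A)
    (hc0r : ∀ x : A, circ x ⊥ = ⊥) (hc0l : ∀ x : A, circ ⊥ x = ⊥)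
    (hcl : ∀ x y z : A, circ x (y ⊔ z) = circ x y ⊔ circ x z)
    (hcr : ∀ x y z : A, circ (y ⊔ z) x = circ y x ⊔ circ z x) :
    ∃ (B : Type u) (_ : DistribLattice B) (_ : BoundedOrder B)
      (circB ldivB rdivB : B → B → B),
      (∀ x y z : B, circB x y ≤ z ↔ y ≤ ldivB x z) ∧
      (∀ x y z : B, circB x y ≤ z ↔ x ≤ rdivB z y) ∧
      ∃ μ : A → B,
        Function.Injective μ ∧
        (∀ a b : A, a ≤ b ↔ μ a ≤ μ b) ∧
        μ ⊥ = ⊥ ∧ μ ⊤ = ⊤ ∧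
        (∀ a b : A, μ (a ⊓ b) = μ a ⊓ μ b) ∧
        (∀ a b : A, μ (a ⊔ b) = μ a ⊔ μ b) ∧
        (∀ a b : A, μ (circ a b) = circB (μ a) (μ b)) := by
  have ml : ∀ x y z : A, y ≤ z → circ x y ≤ circ x z := fun x y z h => by
    rw [← sup_eq_right, ← hcl, sup_eq_right.2 h]
  have mr : ∀ x y z : A, y ≤ z → circ y x ≤ circ z x := fun x y z h => by
    rw [← sup_eq_right, ← hcr, sup_eq_right.2 h]
  let X : Type u := {P : Order.Ideal A // P.IsPrime}
  let R : X → X → X → Prop := fun P Q S => ∀ a b : A, a ∉ P.1 → b ∉ Q.1 → circ a b ∉ S.1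
  let μ : A → Set X := fun a => {P | a ∉ P.1}
  have hle : ∀ a b : A, a ≤ b ↔ μ a ≤ μ b := by
    intro a b
    constructor
    · intro h P hP hb
      exact hP (P.1.lower h hb)
    · intro h
      by_contra hab
      obtain ⟨P, hP, hI, ha⟩ := exists_prime_sep (Order.Ideal.principal b) a
        (fun h => hab (Order.Ideal.mem_principal.1 h))
      have hb : b ∉ P := h (show (⟨P, hP⟩ : X) ∈ μ a from ha)
      exact hb (hI b (Order.Ideal.mem_principal.2 le_rfl))
  refine ⟨Set X, inferInstance, inferInstance,
    fun U V => {S | ∃ P ∈ U, ∃ Q ∈ V, R P Q S},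
    fun U W => {Q | ∀ P ∈ U, ∀ S, R P Q S → S ∈ W},
    fun W V => {P | ∀ Q ∈ V, ∀ S, R P Q S → S ∈ W}, ?_, ?_, μ, ?_, hle, ?_, ?_, ?_, ?_, ?_⟩
  · intro U V W
    constructor
    · intro h Q hQ P hP S hR
      exact h ⟨P, hP, Q, hQ, hR⟩
    · rintro h S ⟨P, hP, Q, hQ, hR⟩
      exact h hQ P hP S hR
  · intro U V W
    constructor
    · intro h P hP Q hQ S hR
      exact h ⟨P, hP, Q, hQ, hR⟩
    · rintro h S ⟨P, hP, Q, hQ, hR⟩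
      exact h hP Q hQ S hR
  · intro a b h
    exact le_antisymm ((hle a b).2 h.le) ((hle b a).2 h.ge)
  · apply Set.eq_empty_of_forall_notMem
    intro P hP
    exact hP P.1.bot_mem
  · apply Set.eq_univ_of_forall
    intro P
    exact P.2.toIsProper.top_notMem
  · intro a b
    ext P
    constructor
    · intro h
      exact ⟨fun ha => h (P.1.lower inf_le_left ha), fun hb => h (P.1.lower inf_le_right hb)⟩
    · rintro ⟨ha, hb⟩ h
      exact (P.2.mem_or_mem h).elim ha hb
  · intro a b
    ext P
    constructor
    · intro h
      by_contra hn
      have h1 : a ∈ P.1 := by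
        by_contra h1
        exact hn (Or.inl h1)
      have h2 : b ∈ P.1 := by
        by_contra h2
        exact hn (Or.inr h2)
      exact h (Order.Ideal.sup_mem h1 h2)
    · rintro (h | h) hs
      · exact h (P.1.lower le_sup_left hs)
      · exact h (P.1.lower le_sup_right hs)
  · intro a b
    ext S
    constructor
    · intro h
      have h : circ a b ∉ S.1 := h
      obtain ⟨P, hP, hIP, haP⟩ := exists_prime_sep_set {x | circ x b ∈ S.1}
        (by
          show circ ⊥ b ∈ S.1
          rw [hc0l]
          exact S.1.bot_mem)
        (fun x y hxy hy => S.1.lower (mr b x y hxy) hy)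
        (fun x y hx hy => by
          show circ (x ⊔ y) b ∈ S.1
          rw [hcr]
          exact Order.Ideal.sup_mem hx hy) a h
      obtain ⟨Q, hQ, hJQ, hbQ⟩ := exists_prime_sep_set {y | ∃ x, x ∉ P ∧ circ x y ∈ S.1}
        ⟨a, haP, by
          rw [hc0r]
          exact S.1.bot_mem⟩
        (by
          rintro y z hyz ⟨x, hx, hz⟩
          exact ⟨x, hx, S.1.lower (ml x y z hyz) hz⟩)
        (by
          rintro y z ⟨x, hx, hy⟩ ⟨w, hw, hz⟩
          refine ⟨x ⊓ w, fun h => (hP.mem_or_mem h).elim hx hw, ?_⟩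
          rw [hcl]
          exact Order.Ideal.sup_mem (S.1.lower (mr y _ _ inf_le_left) hy)
            (S.1.lower (mr z _ _ inf_le_right) hz)) b
        (by
          rintro ⟨x, hx, hxb⟩
          exact hx (hIP x hxb))
      exact ⟨⟨P, hP⟩, haP, ⟨Q, hQ⟩, hbQ, fun x y hx hy hxy => hy (hJQ y ⟨x, hx, hxy⟩)⟩
    · rintro ⟨P, hP, Q, hQ, hR⟩
      exact hR a b hP hQ
end

section
/- Let A be a unital bounded residuated distributive lattice-ordered groupoid (brdge), i.e., a brdg with an element e satisfying x ∘ e = x = e ∘ x for all x. Then for any prime filter F of A there exists a prime filter G of A with e ∈ G and ℛ(F, G, F), and there exists a prime filter H of A with e ∈ H and ℛ(H, F, F), where ℛ(F, G, H) means that for all a, b ∈ A, a ∈ F and b ∈ G imply a ∘ b ∈ H. -/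
theorem exG {A : Type*} [DistribLattice A] [BoundedOrder A]
    (op : A → A → A) (hm : ∀ a a' b b', a ≤ a' → b ≤ b' → op a b ≤ op a' b')
    (hs : ∀ a b c, op a (b ⊔ c) ≤ op a b ⊔ op a c) (hb : ∀ a, op a ⊥ ≤ ⊥)
    (e : A) (he : ∀ x, op x e = x) (F : Set A) (hF : IsPrimeFilter F) :
    ∃ G : Set A, IsPrimeFilter G ∧ e ∈ G ∧ ∀ a b : A, a ∈ F → b ∈ G → op a b ∈ F := by
  obtain ⟨h1, h0, hup, hinf, hsup⟩ := hF
  have hI : Order.IsIdeal {b : A | ∃ a ∈ F, op a b ∉ F} := by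
    refine ⟨?_, ⟨⊥, ⊤, h1, fun h => h0 (hup _ _ h (hb _))⟩, ?_⟩
    · rintro b c hcb ⟨a, ha, hab⟩
      exact ⟨a, ha, fun h => hab (hup _ _ h (hm _ _ _ _ le_rfl hcb))⟩
    · rintro b ⟨a, ha, hab⟩ c ⟨d, hd, hdc⟩
      refine ⟨b ⊔ c, ⟨a ⊓ d, hinf _ _ ha hd, fun h => ?_⟩, le_sup_left, le_sup_right⟩
      rcases hsup _ _ (hup _ _ h (hs _ _ _)) with h | h
      · exact hab (hup _ _ h (hm _ _ _ _ inf_le_left le_rfl))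
      · exact hdc (hup _ _ h (hm _ _ _ _ inf_le_right le_rfl))
  have hd : Disjoint ((Order.PFilter.principal e : Order.PFilter A) : Set A)
      (hI.toIdeal : Set A) := by
    rw [Set.disjoint_left]
    rintro x hx ⟨a, ha, hax⟩
    have hx' : e ≤ x := Order.PFilter.mem_principal.1 hx
    exact hax (hup _ _ ha ((he a).ge.trans (hm _ _ _ _ le_rfl hx')))
  obtain ⟨J, hJ, hIJ, hFJ⟩ := DistribLattice.prime_ideal_of_disjoint_filter_ideal hd
  have heJ : e ∉ J := fun h =>
    Set.disjoint_left.1 hFJ (Order.PFilter.mem_principal.2 le_rfl) h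
  refine ⟨{x | x ∉ J}, ⟨fun h => heJ (J.lower le_top h), fun h => h J.bot_mem,
    fun a b ha hab h => ha (J.lower hab h), fun a b ha hb h => ?_, fun a b h => ?_⟩, heJ, ?_⟩
  · exact (hJ.mem_or_mem h).elim ha hb
  · by_contra hc
    simp only [Set.mem_setOf_eq, not_or, not_not] at hc
    exact h (Order.Ideal.sup_mem hc.1 hc.2)
  · intro a b ha hbG
    by_contra hc
    exact hbG (hIJ ⟨a, ha, hc⟩)

/-- in a unital brdg (brdge) with unit `e`, for any prime filter `F`
there are prime filters `G` with `e ∈ G` and `ℛ(F,G,F)`, and `H` with `e ∈ H` and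
`ℛ(H,F,F)`. -/
theorem stmt18 (A : Type*) [DistribLattice A] [BoundedOrder A]
    (circ ldiv rdiv : A → A → A)
    (res₁ : ∀ x y z : A, circ x y ≤ z ↔ y ≤ ldiv x z)
    (res₂ : ∀ x y z : A, circ x y ≤ z ↔ x ≤ rdiv z y)
    (e : A) (he : ∀ x : A, circ x e = x ∧ circ e x = x)
    (F : Set A) (hF : IsPrimeFilter F) :
    (∃ G : Set A, IsPrimeFilter G ∧ e ∈ G ∧
      ∀ a b : A, a ∈ F → b ∈ G → circ a b ∈ F) ∧
    (∃ H : Set A, IsPrimeFilter H ∧ e ∈ H ∧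
      ∀ a b : A, a ∈ H → b ∈ F → circ a b ∈ F) := by
  have ml : ∀ a b b', b ≤ b' → circ a b ≤ circ a b' := fun a b b' h =>
    (res₁ _ _ _).2 (h.trans ((res₁ _ _ _).1 le_rfl))
  have mr : ∀ a a' b, a ≤ a' → circ a b ≤ circ a' b := fun a a' b h =>
    (res₂ _ _ _).2 (h.trans ((res₂ _ _ _).1 le_rfl))
  constructor
  · exact exG circ (fun a a' b b' h h' => (ml _ _ _ h').trans (mr _ _ _ h))
      (fun a b c => (res₁ _ _ _).2 (sup_le ((res₁ _ _ _).1 le_sup_left)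
        ((res₁ _ _ _).1 le_sup_right)))
      (fun a => (res₁ _ _ _).2 bot_le) e (fun x => (he x).1) F hF
  · obtain ⟨H, h1, h2, h3⟩ := exG (fun a b => circ b a)
      (fun a a' b b' h h' => (ml _ _ _ h).trans (mr _ _ _ h'))
      (fun a b c => (res₂ _ _ _).2 (sup_le ((res₂ _ _ _).1 le_sup_left)
        ((res₂ _ _ _).1 le_sup_right)))
      (fun a => (res₂ _ _ _).2 bot_le) e (fun x => (he x).2) F hF
    exact ⟨H, h1, h2, fun a b ha hb => h3 b a hb ha⟩
end
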